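/- Let ‖·‖_Y be a Haar system Hardy space norm and let x = Σ_{I∈D} a_I h_I ∈ H₀ (finitely supported scalars (a_I)). Then for every k ∈ ℕ₀, one has ‖Σ_{I∈D_k} a_I h_I‖_Y ≤ ‖x‖_Y; in particular, ‖a_I h_I‖_Y ≤ ‖x‖_Y for every I ∈ D. -/

import Mathlib

open MeasureTheory

noncomputable section

/-- A dyadic interval `[i/2^j, (i+1)/2^j) ⊆ [0,1)` (0-based position `i < 2^j`). -/
structure DyadicInt where
  j : ℕ
  i : ℕ
  hi : i < 2 ^ j

noncomputable instance : DecidableEq DyadicInt := Classical.decEq _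

namespace DyadicInt

/-- The underlying set of the dyadic interval. -/
def set (I : DyadicInt) : Set ℝ :=
  Set.Ico ((I.i : ℝ) / 2 ^ I.j) (((I.i : ℝ) + 1) / 2 ^ I.j)

/-- `|I|`, the length of the dyadic interval. -/
def len (I : DyadicInt) : ℝ := 1 / 2 ^ I.j

/-- The left half `I⁺` of `I`. -/
def left (I : DyadicInt) : DyadicInt :=
  ⟨I.j + 1, 2 * I.i, by have := I.hi; simp only [pow_succ]; omega⟩

/-- The right half `I⁻` of `I`. -/
def right (I : DyadicInt) : DyadicInt :=
  ⟨I.j + 1, 2 * I.i + 1, by have := I.hi; simp only [pow_succ]; omega⟩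

/-- The root interval `[0,1)`. -/
def root : DyadicInt := ⟨0, 0, Nat.one_pos⟩

end DyadicInt

/-- The Haar function `h_I = χ_{I⁺} − χ_{I⁻}`. -/
def haar (I : DyadicInt) : ℝ → ℝ :=
  fun s => I.left.set.indicator 1 s - I.right.set.indicator 1 s

/-- `χ_{[0,1)}`. -/
def unitChi : ℝ → ℝ := (Set.Ico (0 : ℝ) 1).indicator 1

/-- The Rademacher function `r_k = Σ_{I ∈ D_k} h_I`. -/
def rademacher (k : ℕ) : ℝ → ℝ :=
  fun s => ∑ i : Fin (2 ^ k), haar ⟨k, i.1, i.2⟩ s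

/-- The collection `D_k` of dyadic intervals of length `2^{-k}`, as a finset. -/
def Dk (k : ℕ) : Finset DyadicInt :=
  (Finset.univ : Finset (Fin (2 ^ k))).image fun i => ⟨k, i.1, i.2⟩

lemma Dk_nonempty (k : ℕ) : (Dk k).Nonempty :=
  ⟨⟨k, 0, Nat.two_pow_pos k⟩,
    Finset.mem_image.2 ⟨⟨0, Nat.two_pow_pos k⟩, Finset.mem_univ _, rfl⟩⟩

/-- The collection `D_{≤ n}`, as a finset. -/
def DleF (n : ℕ) : Finset DyadicInt := (Finset.range (n + 1)).biUnion Dk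

/-- `H`: the linear span of the Haar functions together with `χ_{[0,1)}`. -/
def Hspace : Submodule ℝ (ℝ → ℝ) :=
  Submodule.span ℝ (Set.range haar ∪ {unitChi})

/-- `H₀`: the linear span of the Haar functions. -/
def H0space : Submodule ℝ (ℝ → ℝ) := Submodule.span ℝ (Set.range haar)

/-- `|f|` and `|g|` have the same distribution w.r.t. Lebesgue measure on `[0,1)`. -/
def SameDist (f g : ℝ → ℝ) : Prop :=
  ∀ t : ℝ, volume {s ∈ Set.Ico (0 : ℝ) 1 | t < |f s|}
    = volume {s ∈ Set.Ico (0 : ℝ) 1 | t < |g s|}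

/-- `⟨f, g⟩ = ∫₀¹ f(s) g(s) ds`. -/
def pairing (f g : ℝ → ℝ) : ℝ := ∫ s in Set.Ico (0 : ℝ) 1, f s * g s

/-- A Haar system space norm: a rearrangement-invariant norm on `H`
with `‖χ_{[0,1)}‖ = 1`. -/
structure HaarSystemSpaceNorm where
  normX : (ℝ → ℝ) → ℝ
  nonneg : ∀ f ∈ Hspace, 0 ≤ normX f
  definite : ∀ f ∈ Hspace, normX f = 0 → f = 0
  smul : ∀ (c : ℝ), ∀ f ∈ Hspace, normX (c • f) = |c| * normX f
  triangle : ∀ f ∈ Hspace, ∀ g ∈ Hspace, normX (f + g) ≤ normX f + normX g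
  rearrangement : ∀ f ∈ Hspace, ∀ g ∈ Hspace, SameDist f g → normX f = normX g
  chi_norm : normX unitChi = 1

/-- A Haar system Hardy space norm `‖·‖_Y` on `H₀`, built from a Haar system space
norm `‖·‖_X` and a choice of Rademacher family `r` (either constant `r_0`, or the
independent family `r_{ι(I)}`). -/
structure HaarHardyNorm extends HaarSystemSpaceNorm where
  r : DyadicInt → ℝ → ℝ
  r_spec : (∀ I, r I = rademacher 0) ∨ (∀ I, r I = rademacher (2 ^ I.j + I.i))
  normY : (ℝ → ℝ) → ℝ
  normY_spec : ∀ a : DyadicInt → ℝ, (Function.support a).Finite →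
    normY (fun s => ∑ᶠ I, a I * haar I s)
      = normX (fun s => ∫ u in Set.Ico (0 : ℝ) 1, |∑ᶠ I, r I u * (a I * haar I s)|)

/-- `Y_n`: the linear span of `{h_I : I ∈ D_{≤ n}}`. -/
def Yspan (n : ℕ) : Submodule ℝ (ℝ → ℝ) :=
  Submodule.span ℝ (haar '' {I : DyadicInt | I.j ≤ n})

/-- `h_I` as an element of `Y_N`. -/
def haarY (N : ℕ) (I : DyadicInt) (h : I.j ≤ N) : Yspan N :=
  ⟨haar I, Submodule.subset_span ⟨I, h, rfl⟩⟩

/-- The operator norm (induced by `‖·‖_Y`) of a linear map `Y_n → Y_m`. -/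
def opNorm (nm : HaarHardyNorm) {n m : ℕ} (T : Yspan n →ₗ[ℝ] Yspan m) : ℝ :=
  sInf {C : ℝ | 0 ≤ C ∧ ∀ x : Yspan n, nm.normY (T x).1 ≤ C * nm.normY x.1}

/-- `S` factors through `T` with constant `C` (and error `0`). -/
def Factors (nm : HaarHardyNorm) {n N : ℕ} (S : Yspan n →ₗ[ℝ] Yspan n)
    (T : Yspan N →ₗ[ℝ] Yspan N) (C : ℝ) : Prop :=
  ∃ (B : Yspan n →ₗ[ℝ] Yspan N) (A : Yspan N →ₗ[ℝ] Yspan n),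
    opNorm nm A * opNorm nm B ≤ C ∧ S = A ∘ₗ T ∘ₗ B

/-- `S` factors through `T` with constant `C` and error `η`. -/
def FactorsErr (nm : HaarHardyNorm) {n N : ℕ} (S : Yspan n →ₗ[ℝ] Yspan n)
    (T : Yspan N →ₗ[ℝ] Yspan N) (C η : ℝ) : Prop :=
  ∃ (B : Yspan n →ₗ[ℝ] Yspan N) (A : Yspan N →ₗ[ℝ] Yspan n),
    opNorm nm A * opNorm nm B ≤ C ∧ opNorm nm (S - A ∘ₗ T ∘ₗ B) ≤ η

/-- `S` projectionally factors through `T` with constant `C` and error `η`. -/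
def ProjFactorsErr (nm : HaarHardyNorm) {n N : ℕ} (S : Yspan n →ₗ[ℝ] Yspan n)
    (T : Yspan N →ₗ[ℝ] Yspan N) (C η : ℝ) : Prop :=
  ∃ (B : Yspan n →ₗ[ℝ] Yspan N) (A : Yspan N →ₗ[ℝ] Yspan n),
    opNorm nm A * opNorm nm B ≤ C ∧ opNorm nm (S - A ∘ₗ T ∘ₗ B) ≤ η ∧
      A ∘ₗ B = LinearMap.id

/-- `T : Y_N → Y_N` has `δ`-large positive diagonal. -/
def LargePosDiag (δ : ℝ) {N : ℕ} (T : Yspan N →ₗ[ℝ] Yspan N) : Prop :=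
  ∀ (I : DyadicInt) (h : I.j ≤ N), δ * I.len ≤ pairing (haar I) (T (haarY N I h)).1

/-- `T : Y_N → Y_N` has `δ`-large diagonal. -/
def LargeDiag (δ : ℝ) {N : ℕ} (T : Yspan N →ₗ[ℝ] Yspan N) : Prop :=
  ∀ (I : DyadicInt) (h : I.j ≤ N), δ * I.len ≤ |pairing (haar I) (T (haarY N I h)).1|

/-- The Haar system is `K`-unconditional in `Y`. -/
def Unconditional (nm : HaarHardyNorm) (K : ℝ) : Prop :=
  ∀ a ε : DyadicInt → ℝ, (Function.support a).Finite → (∀ I, ε I = 1 ∨ ε I = -1) →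
    nm.normY (fun s => ∑ᶠ I, ε I * a I * haar I s)
      ≤ K * nm.normY (fun s => ∑ᶠ I, a I * haar I s)

/-- The dual norm `‖y‖_{Y*} = sup { ⟨y, x⟩ : x ∈ H₀, ‖x‖_Y ≤ 1 }`. -/
def dualNorm (nm : HaarHardyNorm) (y : ℝ → ℝ) : ℝ :=
  sSup {c : ℝ | ∃ x ∈ H0space, nm.normY x ≤ 1 ∧ c = pairing y x}

/-- `|B^*|`: the Lebesgue measure of the union of a finite collection of
dyadic intervals. -/
def starMeas (Bf : Finset DyadicInt) : ℝ := (volume (⋃ K ∈ Bf, K.set)).toReal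

/-- The step function taking the value `v i` on `[i/2^n, (i+1)/2^n)` for `i < 2^n`. -/
def dyadicStep (n : ℕ) (v : ℕ → ℝ) : ℝ → ℝ :=
  ∑ i ∈ Finset.range (2 ^ n),
    v i • (Set.Ico ((i : ℝ) / 2 ^ n) (((i : ℝ) + 1) / 2 ^ n)).indicator 1

/-- The value of `haar J` on `[i/2^n, (i+1)/2^n)`, for `n > J.j`. -/
def haarStep (n : ℕ) (J : DyadicInt) (i : ℕ) : ℝ :=
  (if i / 2 ^ (n - J.j - 1) = 2 * J.i then 1 else 0) -
    (if i / 2 ^ (n - J.j - 1) = 2 * J.i + 1 then 1 else 0)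

lemma mem_dyadic_Ico_iff (n i : ℕ) (s : ℝ) :
    s ∈ Set.Ico ((i : ℝ) / 2 ^ n) (((i : ℝ) + 1) / 2 ^ n) ↔ 0 ≤ s ∧ ⌊s * 2 ^ n⌋₊ = i := by
  have h2 : (0 : ℝ) < 2 ^ n := by positivity
  rw [Set.mem_Ico, div_le_iff₀ h2, lt_div_iff₀ h2]
  constructor
  · rintro ⟨h, h'⟩
    have hs : 0 ≤ s := by
      have : (0 : ℝ) ≤ s * 2 ^ n := le_trans (Nat.cast_nonneg i) h
      exact nonneg_of_mul_nonneg_left this h2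
    exact ⟨hs, (Nat.floor_eq_iff (by positivity)).2 ⟨h, h'⟩⟩
  · rintro ⟨hs, h⟩
    exact (Nat.floor_eq_iff (by positivity)).1 h

lemma floor_mul_two_pow_lt {n : ℕ} {s : ℝ} (hs : s ∈ Set.Ico (0 : ℝ) 1) :
    ⌊s * 2 ^ n⌋₊ < 2 ^ n := by
  have h2 : (0 : ℝ) < 2 ^ n := by positivity
  rw [Nat.floor_lt (mul_nonneg hs.1 h2.le)]
  push_cast
  nlinarith [hs.2]

lemma dyadicStep_apply (n : ℕ) (v : ℕ → ℝ) (s : ℝ) :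
    dyadicStep n v s = (Set.Ico (0 : ℝ) 1).indicator (fun s => v ⌊s * 2 ^ n⌋₊) s := by
  simp only [dyadicStep, Finset.sum_apply, Pi.smul_apply, smul_eq_mul, Set.indicator_apply,
    mem_dyadic_Ico_iff, Pi.one_apply, mul_ite, mul_one, mul_zero]
  split_ifs with hs
  · rw [Finset.sum_eq_single ⌊s * 2 ^ n⌋₊]
    · simp [hs.1]
    · intro b _ hb
      exact if_neg fun h => hb h.2.symm
    · intro h
      exact absurd (Finset.mem_range.2 (floor_mul_two_pow_lt hs)) h
  · refine Finset.sum_eq_zero fun i hi => if_neg fun h => hs ⟨h.1, ?_⟩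
    have hi' : ((i : ℝ) + 1) ≤ 2 ^ n := by exact_mod_cast Finset.mem_range.1 hi
    have h1 := ((Nat.floor_eq_iff (mul_nonneg h.1 (by positivity))).1 h.2).2
    have h2 : (0 : ℝ) < 2 ^ n := by positivity
    nlinarith

lemma dyadicStep_add (n : ℕ) (v w : ℕ → ℝ) :
    dyadicStep n (v + w) = dyadicStep n v + dyadicStep n w := by
  simp [dyadicStep, add_smul, Finset.sum_add_distrib]

lemma dyadicStep_smul (n : ℕ) (c : ℝ) (v : ℕ → ℝ) :
    dyadicStep n (c • v) = c • dyadicStep n v := by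
  simp [dyadicStep, mul_smul, Finset.smul_sum]

lemma indicator_set_mem_Hspace (n : ℕ) : ∀ I : DyadicInt, I.j = n →
    I.set.indicator (1 : ℝ → ℝ) ∈ Hspace := by
  induction n with
  | zero =>
    rintro ⟨j, i, hi⟩ rfl
    obtain rfl : i = 0 := by simpa using hi
    refine Submodule.subset_span (Or.inr ?_)
    simp [DyadicInt.set, unitChi]
  | succ n ih =>
    rintro ⟨j, i, hi⟩ (rfl : j = n + 1)
    have hq : i / 2 < 2 ^ n := by rw [pow_succ] at hi; omega
    set P : DyadicInt := ⟨n, i / 2, hq⟩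
    have hP := ih P rfl
    have hh : haar P ∈ Hspace := Submodule.subset_span (Or.inl ⟨P, rfl⟩)
    have hsplit : P.set.indicator (1 : ℝ → ℝ) =
        P.left.set.indicator 1 + P.right.set.indicator 1 := by
      have hl : P.left.set ∪ P.right.set = P.set := by
        simp only [P, DyadicInt.set, DyadicInt.left, DyadicInt.right]
        push_cast
        rw [Set.Ico_union_Ico_eq_Ico (by gcongr; linarith) (by gcongr; linarith)]
        congr 1 <;> (field_simp; ring)
      rw [← hl, Set.indicator_union_of_disjoint]
      · rfl
      · refine Set.disjoint_left.2 fun s h1 h2 => ?_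
        have := ((mem_dyadic_Ico_iff _ _ _).1 h1).2
        have := ((mem_dyadic_Ico_iff _ _ _).1 h2).2
        simp only [P, DyadicInt.left, DyadicInt.right] at *
        omega
    rcases Nat.even_or_odd' i with ⟨m, h | h⟩
    · have : (⟨n + 1, i, hi⟩ : DyadicInt) = P.left := by
        simp only [P, DyadicInt.left, DyadicInt.mk.injEq, true_and]; omega
      rw [this]
      convert Hspace.smul_mem (1 / 2 : ℝ) (Hspace.add_mem hP hh) using 1
      ext s
      simp only [hsplit, haar, Pi.add_apply, Pi.smul_apply, smul_eq_mul]
      ring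
    · have : (⟨n + 1, i, hi⟩ : DyadicInt) = P.right := by
        simp only [P, DyadicInt.right, DyadicInt.mk.injEq, true_and]; omega
      rw [this]
      convert Hspace.smul_mem (1 / 2 : ℝ) (Hspace.sub_mem hP hh) using 1
      ext s
      simp only [hsplit, haar, Pi.add_apply, Pi.sub_apply, Pi.smul_apply, smul_eq_mul]
      ring

lemma dyadicStep_mem_Hspace (n : ℕ) (v : ℕ → ℝ) : dyadicStep n v ∈ Hspace :=
  Hspace.sum_mem fun i hi => Hspace.smul_mem _ <|
    indicator_set_mem_Hspace n ⟨n, i, Finset.mem_range.1 hi⟩ rfl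

lemma volume_lt_abs_dyadicStep (n : ℕ) (v : ℕ → ℝ) (t : ℝ) :
    volume {s ∈ Set.Ico (0 : ℝ) 1 | t < |dyadicStep n v s|} =
      ((Finset.range (2 ^ n)).filter fun i => t < |v i|).card • ENNReal.ofReal (1 / 2 ^ n) := by
  have : {s ∈ Set.Ico (0 : ℝ) 1 | t < |dyadicStep n v s|} =
      ⋃ i ∈ (Finset.range (2 ^ n)).filter fun i => t < |v i|,
        Set.Ico ((i : ℝ) / 2 ^ n) (((i : ℝ) + 1) / 2 ^ n) := by
    ext s
    simp only [Set.mem_ofPred_eq, Set.mem_iUnion, mem_dyadic_Ico_iff, Finset.mem_filter,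
      Finset.mem_range, exists_prop]
    constructor
    · rintro ⟨hs, ht⟩
      rw [dyadicStep_apply, Set.indicator_of_mem hs] at ht
      exact ⟨_, ⟨floor_mul_two_pow_lt hs, ht⟩, hs.1, rfl⟩
    · rintro ⟨i, ⟨hi, ht⟩, hs, rfl⟩
      have hs' : s ∈ Set.Ico (0 : ℝ) 1 := by
        refine ⟨hs, ?_⟩
        have h2 : (0 : ℝ) < 2 ^ n := by positivity
        rw [Nat.floor_lt (by positivity)] at hi
        push_cast at hi
        nlinarith
      rw [dyadicStep_apply, Set.indicator_of_mem hs']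
      exact ⟨hs', ht⟩
  rw [this, measure_biUnion_finset]
  · rw [Finset.sum_congr rfl (g := fun _ => ENNReal.ofReal (1 / 2 ^ n)), Finset.sum_const]
    intro i _
    rw [Real.volume_Ico]
    congr 1
    ring
  · intro i _ i' _ hne
    refine Set.disjoint_left.2 fun s h1 h2 => hne ?_
    rw [← ((mem_dyadic_Ico_iff _ _ _).1 h1).2, ((mem_dyadic_Ico_iff _ _ _).1 h2).2]
  · exact fun _ _ => measurableSet_Ico

namespace HaarSystemSpaceNorm

variable (nm : HaarSystemSpaceNorm) (n : ℕ)

lemma normX_dyadicStep_congr_abs {v w : ℕ → ℝ} (h : ∀ i, |v i| = |w i|) :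
    nm.normX (dyadicStep n v) = nm.normX (dyadicStep n w) := by
  refine nm.rearrangement _ (dyadicStep_mem_Hspace n v) _ (dyadicStep_mem_Hspace n w) fun t => ?_
  simp only [volume_lt_abs_dyadicStep, h]

lemma normX_dyadicStep_xor {c : ℕ} (hc : c < 2 ^ n) (v : ℕ → ℝ) :
    nm.normX (dyadicStep n fun i => v (i ^^^ c)) = nm.normX (dyadicStep n v) := by
  refine nm.rearrangement _ (dyadicStep_mem_Hspace n _) _ (dyadicStep_mem_Hspace n v) fun t => ?_
  rw [volume_lt_abs_dyadicStep, volume_lt_abs_dyadicStep]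
  congr 1
  refine Finset.card_nbij' (· ^^^ c) (· ^^^ c) ?_ ?_ ?_ ?_ <;>
    simp +contextual [Set.MapsTo, Set.LeftInvOn, Nat.xor_lt_two_pow, hc]

lemma normX_dyadicStep_convex {θ : ℝ} (h0 : 0 ≤ θ) (h1 : θ ≤ 1) {v w : ℕ → ℝ}
    (h : nm.normX (dyadicStep n v) = nm.normX (dyadicStep n w)) :
    nm.normX (dyadicStep n (θ • v + (1 - θ) • w)) ≤ nm.normX (dyadicStep n w) := by
  have hv := dyadicStep_mem_Hspace n v
  have hw := dyadicStep_mem_Hspace n w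
  rw [dyadicStep_add, dyadicStep_smul, dyadicStep_smul]
  refine (nm.triangle _ (Hspace.smul_mem _ hv) _ (Hspace.smul_mem _ hw)).trans ?_
  rw [nm.smul _ _ hv, nm.smul _ _ hw, h, abs_of_nonneg h0, abs_of_nonneg (sub_nonneg.2 h1)]
  linarith

lemma normX_dyadicStep_mono {v w : ℕ → ℝ} (h : ∀ i, |v i| ≤ |w i|) :
    nm.normX (dyadicStep n v) ≤ nm.normX (dyadicStep n w) := by
  have key : ∀ A : Finset ℕ, nm.normX (dyadicStep n fun i => if i ∈ A then v i else w i) ≤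
      nm.normX (dyadicStep n w) := by
    intro A
    induction A using Finset.induction_on with
    | empty => simp
    | insert m A hm ih =>
      refine le_trans ?_ ih
      set z : ℕ → ℝ := fun i => if i ∈ A then v i else w i with hz
      obtain ⟨θ, h0, h1, hθ⟩ : ∃ θ : ℝ, 0 ≤ θ ∧ θ ≤ 1 ∧ v m = θ * (-w m) + (1 - θ) * w m := by
        rcases eq_or_ne (w m) 0 with hw | hw
        · have := h m
          rw [hw, abs_zero] at this
          exact ⟨0, le_rfl, zero_le_one, by simp [hw, abs_nonpos_iff.1 this]⟩
        · have hq : |v m / w m| ≤ 1 := by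
            rw [abs_div]; exact div_le_one_of_le₀ (h m) (abs_nonneg _)
          have := abs_le.1 hq
          refine ⟨(1 - v m / w m) / 2, by linarith, by linarith, ?_⟩
          field_simp
          ring
      have hflip : nm.normX (dyadicStep n fun i => if i = m then -z i else z i) =
          nm.normX (dyadicStep n z) :=
        nm.normX_dyadicStep_congr_abs n fun i => by split_ifs <;> simp
      have hcomb : (fun i => if i ∈ insert m A then v i else w i) =
          θ • (fun i => if i = m then -z i else z i) + (1 - θ) • z := by
        ext i
        by_cases him : i = m
        · subst him
          simp [hz, hm, hθ]
        · simp only [Finset.mem_insert, him, false_or, Pi.add_apply, Pi.smul_apply, if_false,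
            smul_eq_mul, hz]
          ring
      rw [hcomb]
      exact nm.normX_dyadicStep_convex n h0 h1 hflip
  convert key (Finset.range (2 ^ n)) using 2
  exact Finset.sum_congr rfl fun i hi => by simp [Finset.mem_range.1 hi]

lemma normX_dyadicStep_sum_xor_le {M : ℕ} (hM : M ≤ 2 ^ n) (v : ℕ → ℝ) :
    nm.normX (dyadicStep n fun i => ∑ c ∈ Finset.range M, v (i ^^^ c)) ≤
      M * nm.normX (dyadicStep n v) := by
  induction M with
  | zero =>
    have := nm.smul 0 _ (dyadicStep_mem_Hspace n v)
    rw [← dyadicStep_smul, zero_smul, abs_zero, zero_mul] at this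
    simpa using! this.le
  | succ M ih =>
    have hs : (fun i => ∑ c ∈ Finset.range (M + 1), v (i ^^^ c)) =
        (fun i => ∑ c ∈ Finset.range M, v (i ^^^ c)) + fun i => v (i ^^^ M) := by
      ext i
      simp [Finset.sum_range_succ]
    rw [hs, dyadicStep_add]
    refine (nm.triangle _ (dyadicStep_mem_Hspace n _) _ (dyadicStep_mem_Hspace n _)).trans ?_
    rw [nm.normX_dyadicStep_xor n (by omega)]
    push_cast
    linarith [ih (by omega)]

/-- A step function dominated by averages of `w` over dyadic blocks has norm at most that
of `w`. -/
lemma normX_dyadicStep_le_of_le_average {M : ℕ} (hM0 : 0 < M) (hM : M ≤ 2 ^ n) {v w : ℕ → ℝ}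
    (h : ∀ i, M * |v i| ≤ ∑ c ∈ Finset.range M, w (i ^^^ c)) :
    nm.normX (dyadicStep n v) ≤ nm.normX (dyadicStep n w) := by
  have hM' : (0 : ℝ) < M := by exact_mod_cast hM0
  refine le_of_mul_le_mul_left ?_ hM'
  calc M * nm.normX (dyadicStep n v) = nm.normX (dyadicStep n ((M : ℝ) • v)) := by
        rw [dyadicStep_smul, nm.smul _ _ (dyadicStep_mem_Hspace n v), abs_of_pos hM']
    _ ≤ nm.normX (dyadicStep n fun i => ∑ c ∈ Finset.range M, w (i ^^^ c)) := by
        refine nm.normX_dyadicStep_mono n fun i => ?_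
        rw [Pi.smul_apply, smul_eq_mul, abs_mul, abs_of_pos hM']
        exact (h i).trans (le_abs_self _)
    _ ≤ _ := nm.normX_dyadicStep_sum_xor_le n hM w

end HaarSystemSpaceNorm

lemma haar_eq_haarStep {n : ℕ} {J : DyadicInt} (hJ : J.j < n) {s : ℝ} (hs : 0 ≤ s) :
    haar J s = haarStep n J ⌊s * 2 ^ n⌋₊ := by
  have hfl : ⌊s * 2 ^ (J.j + 1)⌋₊ = ⌊s * 2 ^ n⌋₊ / 2 ^ (n - J.j - 1) := by
    have hn : n = J.j + 1 + (n - J.j - 1) := by omega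
    have : s * 2 ^ (J.j + 1) = s * 2 ^ n / ((2 ^ (n - J.j - 1) : ℕ) : ℝ) := by
      conv_rhs => rw [hn, pow_add]
      push_cast
      rw [show J.j + 1 + (n - J.j - 1) - J.j - 1 = n - J.j - 1 by omega]
      field_simp
    rw [this, Nat.floor_div_natCast]
  simp only [haar, haarStep, Set.indicator_apply, DyadicInt.set, mem_dyadic_Ico_iff,
    DyadicInt.left, DyadicInt.right, hfl, hs, true_and, Pi.one_apply]

lemma haar_of_notMem {J : DyadicInt} {s : ℝ} (hs : s ∉ Set.Ico (0 : ℝ) 1) : haar J s = 0 := by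
  have key : ∀ I : DyadicInt, s ∉ I.set := by
    rintro ⟨j, i, hi⟩ ⟨h1, h2⟩
    refine hs ⟨le_trans (by positivity) h1, h2.trans_le ?_⟩
    rw [div_le_one (by positivity)]
    exact_mod_cast hi
  simp [haar, key]

lemma haarStep_xor_of_lt {n c : ℕ} {J : DyadicInt} (hc : c < 2 ^ (n - J.j - 1)) (i : ℕ) :
    haarStep n J (i ^^^ c) = haarStep n J i := by
  simp [haarStep, Nat.xor_div_two_pow, Nat.div_eq_of_lt hc]

lemma haarStep_xor_two_pow (n : ℕ) (J : DyadicInt) (i : ℕ) :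
    haarStep n J (i ^^^ 2 ^ (n - J.j - 1)) = -haarStep n J i := by
  have h : (i ^^^ 2 ^ (n - J.j - 1)) / 2 ^ (n - J.j - 1) = i / 2 ^ (n - J.j - 1) ^^^ 1 := by
    simp [Nat.xor_div_two_pow]
  have hx : ∀ t q : ℕ, (t ^^^ 1 = 2 * q ↔ t = 2 * q + 1) ∧ (t ^^^ 1 = 2 * q + 1 ↔ t = 2 * q) := by
    intro t q
    rcases Nat.even_or_odd t with ht | ht
    · rw [Nat.xor_one_of_even ht]
      obtain ⟨m, rfl⟩ := ht
      omega
    · rw [Nat.xor_one_of_odd ht]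
      obtain ⟨m, rfl⟩ := ht
      omega
  simp only [haarStep, h, fun t q => (hx t q).1, fun t q => (hx t q).2]
  ring

lemma haarStep_eq_zero {n i : ℕ} {J : DyadicInt} (hJ : J.j < n) (hi : i / 2 ^ (n - J.j) ≠ J.i) :
    haarStep n J i = 0 := by
  obtain ⟨m, rfl⟩ : ∃ m, n = J.j + m + 1 := ⟨n - J.j - 1, by omega⟩
  rw [show J.j + m + 1 - J.j = m + 1 by omega, pow_succ, ← Nat.div_div_eq_div_mul] at hi
  simp only [haarStep, show J.j + m + 1 - J.j - 1 = m by omega]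
  rw [if_neg (by omega), if_neg (by omega), sub_zero]

lemma haarStep_mul_self {n i : ℕ} {J : DyadicInt} (hJ : J.j < n) (hi : i / 2 ^ (n - J.j) = J.i) :
    haarStep n J i * haarStep n J i = 1 := by
  obtain ⟨m, rfl⟩ : ∃ m, n = J.j + m + 1 := ⟨n - J.j - 1, by omega⟩
  rw [show J.j + m + 1 - J.j = m + 1 by omega, pow_succ, ← Nat.div_div_eq_div_mul] at hi
  simp only [haarStep, show J.j + m + 1 - J.j - 1 = m by omega]
  rcases Nat.mod_two_eq_zero_or_one (i / 2 ^ m) with h | h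
  · rw [if_pos (by omega), if_neg (by omega)]
    norm_num
  · rw [if_neg (by omega), if_pos (by omega)]
    norm_num

lemma abs_haarStep_le_one (n : ℕ) (J : DyadicInt) (i : ℕ) : |haarStep n J i| ≤ 1 := by
  unfold haarStep
  split_ifs <;> norm_num

lemma sum_range_two_pow_eq_zero_of_xor {m b : ℕ} (hb : b < m) {g : ℕ → ℝ}
    (hg : ∀ c, g (c ^^^ 2 ^ b) = -g c) : ∑ c ∈ Finset.range (2 ^ m), g c = 0 := by
  refine Finset.sum_involution (fun c _ => c ^^^ 2 ^ b) ?_ ?_ ?_ ?_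
  · intro c _
    rw [hg, add_neg_cancel]
  · intro c _ hc h
    have := hg c
    rw [h] at this
    exact hc (by linarith)
  · intro c hc
    exact Finset.mem_range.2 (Nat.xor_lt_two_pow (Finset.mem_range.1 hc)
      (Nat.pow_lt_pow_right one_lt_two hb))
  · intro c _
    simp

/-- Orthogonality of the Haar system on the block of `2 ^ (n - I.j)` indices subordinate to `I`. -/
lemma sum_haarStep_mul_haarStep {n i : ℕ} {I J : DyadicInt} (hI : I.j < n) (hJ : J.j < n)
    (hi : i / 2 ^ (n - I.j) = I.i) :
    ∑ c ∈ Finset.range (2 ^ (n - I.j)), haarStep n I (i ^^^ c) * haarStep n J (i ^^^ c) =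
      if J = I then 2 ^ (n - I.j) else 0 := by
  have hblock : ∀ c ∈ Finset.range (2 ^ (n - I.j)), (i ^^^ c) / 2 ^ (n - I.j) = I.i := by
    intro c hc
    rw [Nat.xor_div_two_pow, Nat.div_eq_of_lt (Finset.mem_range.1 hc), Nat.xor_zero, hi]
  split_ifs with hJI
  · subst hJI
    rw [Finset.sum_congr rfl fun c hc => haarStep_mul_self hJ (hblock c hc)]
    simp
  · rcases lt_trichotomy I.j J.j with h | h | h
    · refine sum_range_two_pow_eq_zero_of_xor (b := n - J.j - 1) (by omega) fun c => ?_
      rw [← Nat.xor_assoc, haarStep_xor_two_pow,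
        haarStep_xor_of_lt (Nat.pow_lt_pow_right one_lt_two (by omega))]
      ring
    · refine Finset.sum_eq_zero fun c hc => ?_
      rw [haarStep_eq_zero hJ, mul_zero]
      rw [← h, hblock c hc]
      intro h'
      cases I; cases J
      simp_all
    · refine sum_range_two_pow_eq_zero_of_xor (b := n - I.j - 1) (by omega) fun c => ?_
      rw [← Nat.xor_assoc, haarStep_xor_two_pow,
        haarStep_xor_of_lt (Nat.pow_lt_pow_right one_lt_two (by omega))]
      ring

lemma integrableOn_rademacher (k : ℕ) : IntegrableOn (rademacher k) (Set.Ico 0 1) := by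
  have h : ∀ I : DyadicInt, IntegrableOn (I.set.indicator (1 : ℝ → ℝ)) (Set.Ico 0 1) := fun I =>
    (integrable_const (1 : ℝ)).indicator measurableSet_Ico
  unfold rademacher
  exact integrable_finsetSum _ fun i _ => (h _).sub (h _)

namespace HaarHardyNorm

variable (nm : HaarHardyNorm)

lemma integrableOn_r (I : DyadicInt) : IntegrableOn (nm.r I) (Set.Ico 0 1) := by
  rcases nm.r_spec with h | h <;> rw [h] <;> exact integrableOn_rademacher _

lemma integral_abs_finsum_eq_dyadicStep {n : ℕ} {a : DyadicInt → ℝ}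
    (ha : ∀ I, a I ≠ 0 → I.j < n) :
    (fun s => ∫ u in Set.Ico (0 : ℝ) 1, |∑ᶠ I, nm.r I u * (a I * haar I s)|) =
      dyadicStep n fun i =>
        ∫ u in Set.Ico (0 : ℝ) 1, |∑ᶠ I, nm.r I u * (a I * haarStep n I i)| := by
  ext s
  rw [dyadicStep_apply]
  by_cases hs : s ∈ Set.Ico (0 : ℝ) 1
  · rw [Set.indicator_of_mem hs]
    have : ∀ I, a I * haar I s = a I * haarStep n I ⌊s * 2 ^ n⌋₊ := by
      intro I
      rcases eq_or_ne (a I) 0 with h | h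
      · simp [h]
      · rw [haar_eq_haarStep (ha I h) hs.1]
    simp only [this]
  · simp [Set.indicator_of_notMem hs, haar_of_notMem hs]

/-- Restricting the coefficients to intervals of a single level does not increase the norm. -/
lemma normY_indicator_le {a : DyadicInt → ℝ} (ha : (Function.support a).Finite) {k : ℕ}
    {S : Set DyadicInt} (hS : ∀ I ∈ S, I.j = k) :
    nm.normY (fun s => ∑ᶠ I, S.indicator a I * haar I s) ≤
      nm.normY (fun s => ∑ᶠ I, a I * haar I s) := by
  have hb : (Function.support (S.indicator a)).Finite :=
    ha.subset (by rw [Set.support_indicator]; exact Set.inter_subset_right)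
  obtain ⟨n, hkn, hn⟩ : ∃ n, k < n ∧ ∀ I, a I ≠ 0 → I.j < n := by
    refine ⟨max k (ha.toFinset.sup DyadicInt.j) + 1, by omega, fun I hI => ?_⟩
    have : I.j ≤ ha.toFinset.sup DyadicInt.j :=
      Finset.le_sup (f := DyadicInt.j) (ha.mem_toFinset.2 hI)
    omega
  have hn' : ∀ I, S.indicator a I ≠ 0 → I.j < n := fun I hI => by
    rw [hS I (Set.mem_of_indicator_ne_zero hI)]
    exact hkn
  rw [nm.normY_spec _ hb, nm.normY_spec _ ha, nm.integral_abs_finsum_eq_dyadicStep hn,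
    nm.integral_abs_finsum_eq_dyadicStep hn']
  refine nm.normX_dyadicStep_le_of_le_average n (M := 2 ^ (n - k)) (by positivity)
    (Nat.pow_le_pow_right two_pos (by omega)) fun i => ?_
  have hfin : ∀ u m, ∑ᶠ J, nm.r J u * (a J * haarStep n J m) =
      ∑ J ∈ ha.toFinset, nm.r J u * (a J * haarStep n J m) := fun u m => by
    refine finsum_eq_sum_of_support_subset _ fun J hJ => ?_
    rw [ha.coe_toFinset]
    intro h
    simp [h] at hJ
  by_cases hex : ∃ I ∈ S, I.i = i / 2 ^ (n - k)
  · obtain ⟨I, hIS, hIi⟩ := hex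
    obtain rfl := hS I hIS
    have hsingle : ∀ u, ∑ᶠ J, nm.r J u * (S.indicator a J * haarStep n J i) =
        nm.r I u * (a I * haarStep n I i) := fun u => by
      rw [finsum_eq_single _ I, Set.indicator_of_mem hIS]
      intro J hJ
      by_cases hJS : J ∈ S
      · have hj := hS J hJS
        rw [haarStep_eq_zero (by omega), mul_zero, mul_zero]
        rw [hj, ← hIi]
        intro h
        apply hJ
        cases I; cases J
        simp_all
      · simp [hJS]
    simp only [hsingle, hfin]
    rw [abs_of_nonneg (integral_nonneg fun _ => abs_nonneg _), ← integral_const_mul,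
      ← integral_finsetSum]
    · refine integral_mono (((nm.integrableOn_r I).mul_const _).abs.const_mul _)
        (integrable_finsetSum _ fun c _ => (integrable_finsetSum _ fun J _ =>
          (nm.integrableOn_r J).mul_const _).abs) fun u => ?_
      have hpair : ∑ c ∈ Finset.range (2 ^ (n - I.j)), haarStep n I (i ^^^ c) *
          ∑ J ∈ ha.toFinset, nm.r J u * (a J * haarStep n J (i ^^^ c)) =
            2 ^ (n - I.j) * (nm.r I u * a I) := by
        simp only [Finset.mul_sum]
        rw [Finset.sum_comm]
        have : ∀ J ∈ ha.toFinset, ∑ c ∈ Finset.range (2 ^ (n - I.j)), haarStep n I (i ^^^ c) *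
            (nm.r J u * (a J * haarStep n J (i ^^^ c))) =
              if J = I then 2 ^ (n - I.j) * (nm.r I u * a I) else 0 := by
          intro J hJ
          rw [Finset.sum_congr rfl fun c _ => show haarStep n I (i ^^^ c) *
            (nm.r J u * (a J * haarStep n J (i ^^^ c))) = nm.r J u * a J *
              (haarStep n I (i ^^^ c) * haarStep n J (i ^^^ c)) by ring, ← Finset.mul_sum,
            sum_haarStep_mul_haarStep hkn (hn J (ha.mem_toFinset.1 hJ)) hIi.symm]
          split_ifs with h
          · rw [h, mul_comm]
          · rw [mul_zero]
        rw [Finset.sum_congr rfl this, Finset.sum_ite_eq', ite_eq_left_iff]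
        intro h
        have : a I = 0 := by simpa using h
        simp [this]
      calc ((2 ^ (n - I.j) : ℕ) : ℝ) * |nm.r I u * (a I * haarStep n I i)|
          = |2 ^ (n - I.j) * (nm.r I u * a I)| * |haarStep n I i| := by
            simp only [abs_mul]
            push_cast
            rw [abs_of_pos (by positivity : (0 : ℝ) < 2 ^ (n - I.j))]
            ring
        _ ≤ |2 ^ (n - I.j) * (nm.r I u * a I)| :=
            mul_le_of_le_one_right (abs_nonneg _) (abs_haarStep_le_one _ _ _)
        _ ≤ _ := by
            rw [← hpair]
            refine (Finset.abs_sum_le_sum_abs _ _).trans (Finset.sum_le_sum fun c _ => ?_)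
            rw [abs_mul]
            exact mul_le_of_le_one_left (abs_nonneg _) (abs_haarStep_le_one _ _ _)
    · exact fun c _ => (integrable_finsetSum _ fun J _ =>
        (nm.integrableOn_r J).mul_const _).abs
  · have hzero : ∀ J, S.indicator a J * haarStep n J i = 0 := fun J => by
      by_cases hJS : J ∈ S
      · have hj := hS J hJS
        rw [haarStep_eq_zero (by omega), mul_zero]
        rw [hj]
        exact fun h => hex ⟨J, hJS, h.symm⟩
      · simp [hJS]
    simp only [hzero, mul_zero, finsum_zero, abs_zero, integral_zero]
    exact Finset.sum_nonneg fun c _ => integral_nonneg fun _ => abs_nonneg _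

end HaarHardyNorm

lemma mem_Dk_iff {k : ℕ} {I : DyadicInt} : I ∈ Dk k ↔ I.j = k := by
  simp only [Dk, Finset.mem_image, Finset.mem_univ, true_and]
  constructor
  · rintro ⟨i, rfl⟩
    rfl
  · rintro rfl
    exact ⟨⟨I.i, I.hi⟩, rfl⟩

/-- the norm of each level of the Haar expansion is dominated
by the norm of the whole sum. -/
theorem statement16 (nm : HaarHardyNorm) (a : DyadicInt → ℝ)
    (ha : (Function.support a).Finite) :
    (∀ k : ℕ, nm.normY (fun s => ∑ I ∈ Dk k, a I * haar I s)
        ≤ nm.normY (fun s => ∑ᶠ I, a I * haar I s)) ∧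
    (∀ I : DyadicInt, nm.normY (fun s => a I * haar I s)
        ≤ nm.normY (fun s => ∑ᶠ I, a I * haar I s)) := by
  refine ⟨fun k => ?_, fun I => ?_⟩
  · convert nm.normY_indicator_le ha (S := (Dk k : Set DyadicInt))
      (fun I hI => mem_Dk_iff.1 (Finset.mem_coe.1 hI)) using 2
    ext s
    rw [finsum_eq_sum_of_support_subset (s := Dk k)]
    · exact Finset.sum_congr rfl fun I hI => by rw [Set.indicator_of_mem (Finset.mem_coe.2 hI)]
    · intro I hI
      by_contra h
      exact hI (mul_eq_zero_of_left (Set.indicator_of_notMem h a) _)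
  · convert nm.normY_indicator_le ha (S := {I}) (k := I.j) (by rintro J rfl; rfl) using 2
    ext s
    rw [finsum_eq_single _ I]
    · simp
    · intro J hJ
      simp [hJ]
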